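/- arXiv:2002.02264 — 8 statements merged into one kernel-verified Lean document; each statement's English description precedes it below -/
import Mathlib

section
/- Let S1 ∈ ℝ_+^{m1×n1} and S2 ∈ ℝ_+^{m2×n2} be nonnegative matrices with n1, n2 ≥ 1, and let S = S1 ⊗ S2 be their 1-product. Then conv(col(S)) = conv(col(S1)) × conv(col(S2)), and S is a slack matrix if and only if both S1 and S2 are slack matrices. -/
/-- The set of columns of a matrix. -/
def colSet {ι κ : Type*} (S : Matrix ι κ ℝ) : Set (ι → ℝ) :=
  Set.range (fun j => fun i => S i j)

/-- A nonnegative matrix `S` is a slack matrix (in the sense of the characterization of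
Gouveia et al.) if `conv(col(S)) = aff(col(S)) ∩ ℝ₊^m`. -/
def IsSlackMatrix {ι κ : Type*} (S : Matrix ι κ ℝ) : Prop :=
  (∀ i j, 0 ≤ S i j) ∧
    convexHull ℝ (colSet S)
      = (affineSpan ℝ (colSet S) : Set (ι → ℝ)) ∩ {x | ∀ i, 0 ≤ x i}

/-- The 1-product of two matrices. -/
def oneProduct {m1 n1 m2 n2 : ℕ} (S1 : Matrix (Fin m1) (Fin n1) ℝ)
    (S2 : Matrix (Fin m2) (Fin n2) ℝ) :
    Matrix (Fin m1 ⊕ Fin m2) (Fin n1 × Fin n2) ℝ :=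
  fun i j => Sum.elim (fun i1 => S1 i1 j.1) (fun i2 => S2 i2 j.2) i

theorem colSet_nonempty {ι κ : Type*} [Nonempty κ] (S : Matrix ι κ ℝ) : (colSet S).Nonempty :=
  Set.range_nonempty _

theorem colSet_oneProduct {m1 n1 m2 n2 : ℕ} (S1 : Matrix (Fin m1) (Fin n1) ℝ)
    (S2 : Matrix (Fin m2) (Fin n2) ℝ) :
    colSet (oneProduct S1 S2) =
      (LinearEquiv.sumArrowLequivProdArrow (Fin m1) (Fin m2) ℝ ℝ).symm ''
        (colSet S1 ×ˢ colSet S2) := by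
  ext x
  constructor
  · rintro ⟨j, rfl⟩
    refine ⟨(fun i => S1 i j.1, fun i => S2 i j.2), ⟨⟨j.1, rfl⟩, ⟨j.2, rfl⟩⟩, ?_⟩
    ext (i | i) <;> rfl
  · rintro ⟨⟨_, _⟩, ⟨⟨j, rfl⟩, ⟨l, rfl⟩⟩, rfl⟩
    refine ⟨(j, l), ?_⟩
    ext (i | i) <;> rfl

theorem convexHull_colSet_oneProduct {m1 n1 m2 n2 : ℕ} (S1 : Matrix (Fin m1) (Fin n1) ℝ)
    (S2 : Matrix (Fin m2) (Fin n2) ℝ) :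
    convexHull ℝ (colSet (oneProduct S1 S2)) =
      (LinearEquiv.sumArrowLequivProdArrow (Fin m1) (Fin m2) ℝ ℝ).symm ''
        (convexHull ℝ (colSet S1) ×ˢ convexHull ℝ (colSet S2)) := by
  rw [colSet_oneProduct, ← convexHull_prod]
  exact (LinearMap.image_convexHull
    (LinearEquiv.sumArrowLequivProdArrow (Fin m1) (Fin m2) ℝ ℝ).symm.toLinearMap _).symm

theorem affineSpan_colSet_oneProduct {m1 n1 m2 n2 : ℕ} (S1 : Matrix (Fin m1) (Fin n1) ℝ)
    (S2 : Matrix (Fin m2) (Fin n2) ℝ) :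
    (affineSpan ℝ (colSet (oneProduct S1 S2)) : Set (Fin m1 ⊕ Fin m2 → ℝ)) =
      (LinearEquiv.sumArrowLequivProdArrow (Fin m1) (Fin m2) ℝ ℝ).symm ''
        ((affineSpan ℝ (colSet S1) : Set (Fin m1 → ℝ)) ×ˢ
          (affineSpan ℝ (colSet S2) : Set (Fin m2 → ℝ))) := by
  rw [colSet_oneProduct, ← AffineSubspace.coe_prod, ← affineSpan_prod_eq]
  exact congrArg SetLike.coe (AffineSubspace.map_span
    (LinearEquiv.sumArrowLequivProdArrow (Fin m1) (Fin m2) ℝ ℝ).symm.toLinearMap.toAffineMap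
    (colSet S1 ×ˢ colSet S2)).symm

theorem setOf_nonneg_sum_eq_image (m1 m2 : ℕ) :
    {x : Fin m1 ⊕ Fin m2 → ℝ | ∀ i, 0 ≤ x i} =
      (LinearEquiv.sumArrowLequivProdArrow (Fin m1) (Fin m2) ℝ ℝ).symm ''
        ({x : Fin m1 → ℝ | ∀ i, 0 ≤ x i} ×ˢ {x : Fin m2 → ℝ | ∀ i, 0 ≤ x i}) := by
  ext x
  rw [LinearEquiv.image_symm_eq_preimage]
  exact Sum.forall

/-- If `S1, S2` are nonnegative matrices with at least one column each, and
`S = S1 ⊗ S2` is their 1-product, then `conv(col(S)) = conv(col(S1)) × conv(col(S2))`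
(under the identification `ℝ^{m1} × ℝ^{m2} ≅ ℝ^{m1+m2}`), and `S` is a slack matrix
iff both `S1` and `S2` are slack matrices. -/
theorem oneProduct_slack {m1 n1 m2 n2 : ℕ}
    (S1 : Matrix (Fin m1) (Fin n1) ℝ) (S2 : Matrix (Fin m2) (Fin n2) ℝ)
    (hS1 : ∀ i j, 0 ≤ S1 i j) (hS2 : ∀ i j, 0 ≤ S2 i j)
    (hn1 : 1 ≤ n1) (hn2 : 1 ≤ n2) :
    convexHull ℝ (colSet (oneProduct S1 S2))
        = (fun p : (Fin m1 → ℝ) × (Fin m2 → ℝ) => Sum.elim p.1 p.2) ''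
            ((convexHull ℝ (colSet S1)) ×ˢ (convexHull ℝ (colSet S2)))
      ∧ (IsSlackMatrix (oneProduct S1 S2) ↔ IsSlackMatrix S1 ∧ IsSlackMatrix S2) := by
  have : Nonempty (Fin n1) := ⟨⟨0, hn1⟩⟩
  have : Nonempty (Fin n2) := ⟨⟨0, hn2⟩⟩
  have hS : ∀ i j, 0 ≤ oneProduct S1 S2 i j := by
    rintro (i | i) j
    exacts [hS1 i j.1, hS2 i j.2]
  refine ⟨convexHull_colSet_oneProduct S1 S2, ?_⟩
  have hne : (convexHull ℝ (colSet S1) ×ˢ convexHull ℝ (colSet S2)).Nonempty :=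
    (colSet_nonempty S1).convexHull.prod (colSet_nonempty S2).convexHull
  rw [IsSlackMatrix, IsSlackMatrix, IsSlackMatrix, and_iff_right hS, and_iff_right hS1,
    and_iff_right hS2, convexHull_colSet_oneProduct, affineSpan_colSet_oneProduct,
    setOf_nonneg_sum_eq_image, ← Set.image_inter (LinearEquiv.injective _), Set.prod_inter_prod,
    (LinearEquiv.injective _).image_injective.eq_iff, Set.prod_eq_prod_iff_of_nonempty hne]
end

section
/- Let V1 ⊆ ℝ^{m1} and V2 ⊆ ℝ^{m2} be finite sets such that the first coordinate of every point of V1 lies in {0,1} and the first coordinate of every point of V2 lies in {0,1}. Let H = {(x,y) ∈ ℝ^{m1} × ℝ^{m2} : x_1 = y_1}. Then every extreme point of the polytope (conv(V1) × conv(V2)) ∩ H belongs to V1 × V2. -/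
section LinearFunctional

variable {E F : Type*} [AddCommGroup E] [Module ℝ E] [AddCommGroup F] [Module ℝ F]

/-- A linear functional that is constant on a set takes the same value on its convex hull. -/
theorem LinearMap.eq_of_mem_convexHull (f : E →ₗ[ℝ] ℝ) {s : Set E} {c : ℝ}
    (hs : ∀ x ∈ s, f x = c) {x : E} (hx : x ∈ convexHull ℝ s) : f x = c :=
  convexHull_min (t := {x | f x = c}) hs (convex_hyperplane f.isLinear c) hx

/-- If a linear functional takes only the values `0` and `1` on `s`, then every point `x` of the
convex hull of `s` is the combination, with weights `1 - f x` and `f x`, of points in the convex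
hulls of the two level sets. A point whose weight vanishes is unconstrained. -/
theorem LinearMap.exists_convexHull_level_decomposition (f : E →ₗ[ℝ] ℝ) {s : Set E}
    (hs : ∀ x ∈ s, f x = 0 ∨ f x = 1) {x : E} (hx : x ∈ convexHull ℝ s) :
    0 ≤ f x ∧ f x ≤ 1 ∧ ∃ a b, x = (1 - f x) • a + f x • b ∧
      (f x ≠ 1 → a ∈ convexHull ℝ {v ∈ s | f v = 0}) ∧
      (f x ≠ 0 → b ∈ convexHull ℝ {v ∈ s | f v = 1}) := by
  have hunion : s = {v ∈ s | f v = 0} ∪ {v ∈ s | f v = 1} := by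
    rw [← Set.sep_or]
    exact (Set.sep_eq_self_iff_mem_true.2 hs).symm
  rcases Set.eq_empty_or_nonempty {v ∈ s | f v = 0} with h0 | h0
  · rw [h0, Set.empty_union] at hunion
    rw [hunion] at hx
    have hfx : f x = 1 := f.eq_of_mem_convexHull (fun v hv => hv.2) hx
    exact ⟨by simp [hfx], hfx.le, x, x, by simp [hfx], fun h => absurd hfx h, fun _ => hx⟩
  rcases Set.eq_empty_or_nonempty {v ∈ s | f v = 1} with h1 | h1
  · rw [h1, Set.union_empty] at hunion
    rw [hunion] at hx
    have hfx : f x = 0 := f.eq_of_mem_convexHull (fun v hv => hv.2) hx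
    exact ⟨hfx.ge, by simp [hfx], x, x, by simp [hfx], fun _ => hx, fun h => absurd hfx h⟩
  rw [hunion, convexHull_union h0 h1, mem_convexJoin] at hx
  obtain ⟨a, ha, b, hb, t, u, ht, hu, htu, rfl⟩ := hx
  have hfa : f a = 0 := f.eq_of_mem_convexHull (fun v hv => hv.2) ha
  have hfb : f b = 1 := f.eq_of_mem_convexHull (fun v hv => hv.2) hb
  have hfx : f (t • a + u • b) = u := by simp [hfa, hfb]
  have ht' : 1 - u = t := by linarith
  rw [hfx, ht']
  exact ⟨hu, by linarith, a, b, rfl, fun _ => ha, fun _ => hb⟩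

/-- If `f` and `g` take only the values `0` and `1` on `s` and `t`, then intersecting
`conv s × conv t` with the hyperplane `f x = g y` gives a subset of the convex hull of the points
of `s × t` on that hyperplane. -/
theorem convexHull_prod_inter_eq_subset (f : E →ₗ[ℝ] ℝ) (g : F →ₗ[ℝ] ℝ) {s : Set E} {t : Set F}
    (hs : ∀ x ∈ s, f x = 0 ∨ f x = 1) (ht : ∀ y ∈ t, g y = 0 ∨ g y = 1) :
    (convexHull ℝ s ×ˢ convexHull ℝ t) ∩ {q : E × F | f q.1 = g q.2} ⊆
      convexHull ℝ ((s ×ˢ t) ∩ {q : E × F | f q.1 = g q.2}) := by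
  rintro ⟨x, y⟩ ⟨⟨hx, hy⟩, hxy⟩
  replace hxy : f x = g y := hxy
  obtain ⟨h0, h1, a, b, hxab, ha, hb⟩ := f.exists_convexHull_level_decomposition hs hx
  obtain ⟨-, -, a', b', hyab, ha', hb'⟩ := g.exists_convexHull_level_decomposition ht hy
  rw [← hxy] at hyab ha' hb'
  have level (c : ℝ) {p : E} {q : F} (hp : p ∈ convexHull ℝ {v ∈ s | f v = c})
      (hq : q ∈ convexHull ℝ {v ∈ t | g v = c}) :
      (p, q) ∈ convexHull ℝ ((s ×ˢ t) ∩ {q : E × F | f q.1 = g q.2}) := by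
    have hpq : (p, q) ∈ convexHull ℝ ({v ∈ s | f v = c} ×ˢ {v ∈ t | g v = c}) := by
      rw [convexHull_prod]
      exact ⟨hp, hq⟩
    refine convexHull_mono ?_ hpq
    intro z hz
    exact ⟨⟨hz.1.1, hz.2.1⟩, hz.1.2.trans hz.2.2.symm⟩
  have hcomb : (x, y) = (1 - f x) • (a, a') + f x • (b, b') := Prod.ext hxab hyab
  by_cases hf0 : f x = 0
  · rw [hcomb, hf0, sub_zero, one_smul, zero_smul, add_zero]
    have hne : f x ≠ 1 := by simp [hf0]
    exact level 0 (ha hne) (ha' hne)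
  by_cases hf1 : f x = 1
  · rw [hcomb, hf1, sub_self, one_smul, zero_smul, zero_add]
    exact level 1 (hb hf0) (hb' hf0)
  rw [hcomb]
  exact convex_convexHull ℝ _ (level 0 (ha hf1) (ha' hf1)) (level 1 (hb hf0) (hb' hf0))
    (sub_nonneg.2 h1) h0 (sub_add_cancel 1 (f x))

end LinearFunctional


/-- Let `V1 ⊆ ℝ^{m1}` and `V2 ⊆ ℝ^{m2}` be finite sets whose points all have
first coordinate in `{0,1}`, and let `H = {(x,y) : x_1 = y_1}`. Then every extreme point of the
polytope `(conv(V1) × conv(V2)) ∩ H` belongs to `V1 × V2`. -/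
theorem extremePoints_prod_inter_hyperplane {m1 m2 : ℕ}
    (V1 : Set (Fin (m1 + 1) → ℝ)) (V2 : Set (Fin (m2 + 1) → ℝ))
    (hV1fin : V1.Finite) (hV2fin : V2.Finite)
    (hV1 : ∀ x ∈ V1, x 0 = 0 ∨ x 0 = 1) (hV2 : ∀ y ∈ V2, y 0 = 0 ∨ y 0 = 1) :
    ∀ p ∈ Set.extremePoints ℝ
        (((convexHull ℝ V1) ×ˢ (convexHull ℝ V2)) ∩
          {q : (Fin (m1 + 1) → ℝ) × (Fin (m2 + 1) → ℝ) | q.1 0 = q.2 0}),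
      p ∈ V1 ×ˢ V2 := by
  intro p hp
  have hsub := convexHull_prod_inter_eq_subset
    (LinearMap.proj 0 : (Fin (m1 + 1) → ℝ) →ₗ[ℝ] ℝ)
    (LinearMap.proj 0 : (Fin (m2 + 1) → ℝ) →ₗ[ℝ] ℝ) hV1 hV2
  have hconv : Convex ℝ ((convexHull ℝ V1 ×ˢ convexHull ℝ V2) ∩
      {q : (Fin (m1 + 1) → ℝ) × (Fin (m2 + 1) → ℝ) | q.1 0 = q.2 0}) := by
    refine ((convex_convexHull ℝ V1).prod (convex_convexHull ℝ V2)).inter ?_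
    intro q hq r hr α β _ _ _
    simp only [Set.mem_ofPred_eq] at hq hr
    simp [hq, hr]
  have heq := hsub.antisymm <| convexHull_min
    (Set.inter_subset_inter_left _
      (Set.prod_mono (subset_convexHull ℝ V1) (subset_convexHull ℝ V2))) hconv
  simp only [LinearMap.proj_apply] at heq
  rw [heq] at hp
  exact (extremePoints_convexHull_subset hp).1
end

section
/- Let S1 ∈ ℝ_+^{m1×n1} have a designated 0/1-valued row x1 and S2 ∈ ℝ_+^{m2×n2} a designated 0/1-valued row y1, where each of x1 and y1 takes both values 0 and 1. If S1 and S2 are both slack matrices, then the 2-product S = (S1,x1) ⊗₂ (S2,y1) is a slack matrix. -/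
/-- The 2-product `(S1, x1) ⊗₂ (S2, y1)` of `S1` with special (0/1) row `r1` and `S2` with
special (0/1) row `r2`.  Its columns are indexed by the pairs `(k, ℓ)` of columns of `S1` and
`S2` having equal special entries (`S1 r1 k = S2 r2 ℓ ∈ {0,1}`); such a column is the
concatenation of column `k` of `S1` without row `r1`, column `ℓ` of `S2` without row `r2`,
and one extra entry equal to the common special value.  This realizes the matrix whose columns
are those of `S1⁰ ⊗ S2⁰` followed by those of `S1¹ ⊗ S2¹`, with an appended row that is `0` on
the first block and `1` on the second block. -/
def twoProduct {m1 n1 m2 n2 : ℕ} (S1 : Matrix (Fin m1) (Fin n1) ℝ)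
    (S2 : Matrix (Fin m2) (Fin n2) ℝ) (r1 : Fin m1) (r2 : Fin m2) :
    Matrix (({i : Fin m1 // i ≠ r1} ⊕ {i : Fin m2 // i ≠ r2}) ⊕ Unit)
      {p : Fin n1 × Fin n2 // S1 r1 p.1 = S2 r2 p.2} ℝ :=
  fun i j =>
    match i with
    | Sum.inl (Sum.inl i1) => S1 i1.1 j.1.1
    | Sum.inl (Sum.inr i2) => S2 i2.1 j.1.2
    | Sum.inr _ => S1 r1 j.1.1

open Finset in
/-- Two finite nonnegative weights with equal pushforwards along `a` and `b` have a coupling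
supported on the fibre product of `a` and `b`. -/
lemma exists_coupling_of_fiber_sums_eq {α β γ : Type*} [Fintype α] [Fintype β] [DecidableEq γ]
    (a : α → γ) (b : β → γ) (u : α → ℝ) (v : β → ℝ) (hu : ∀ k, 0 ≤ u k) (hv : ∀ l, 0 ≤ v l)
    (h : ∀ c, (∑ k, if a k = c then u k else 0) = ∑ l, if b l = c then v l else 0) :
    ∃ w : {p : α × β // a p.1 = b p.2} → ℝ, (∀ p, 0 ≤ w p) ∧
      (∀ g : α → ℝ, ∑ p, w p * g p.1.1 = ∑ k, u k * g k) ∧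
      (∀ g : β → ℝ, ∑ p, w p * g p.1.2 = ∑ l, v l * g l) := by
  set m : γ → ℝ := fun c => ∑ k, if a k = c then u k else 0 with hm
  have hm0 (c : γ) : 0 ≤ m c := sum_nonneg fun k _ => by split_ifs <;> simp [hu]
  have hum (k : α) : u k / m (a k) * m (a k) = u k := by
    refine div_mul_cancel_of_imp fun h0 => ?_
    have := (sum_eq_zero_iff_of_nonneg fun k _ => by split_ifs <;> simp [hu]).1 h0 k (mem_univ k)
    simpa using this
  have hvm (l : β) : v l / m (b l) * m (b l) = v l := by
    refine div_mul_cancel_of_imp fun h0 => ?_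
    replace h0 := (h (b l)).symm.trans h0
    have := (sum_eq_zero_iff_of_nonneg fun l _ => by split_ifs <;> simp [hv]).1 h0 l (mem_univ l)
    simpa using this
  have hsub (f : α × β → ℝ) : ∑ p : {p : α × β // a p.1 = b p.2}, f p.1
      = ∑ p : α × β, if a p.1 = b p.2 then f p else 0 := by
    rw [← sum_filter]
    exact (sum_subtype _ (by simp) f).symm
  refine ⟨fun p => u p.1.1 * v p.1.2 / m (a p.1.1),
    fun p => div_nonneg (mul_nonneg (hu _) (hv _)) (hm0 _), fun g => ?_, fun g => ?_⟩
  · rw [hsub fun p => u p.1 * v p.2 / m (a p.1) * g p.1, Fintype.sum_prod_type]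
    refine sum_congr rfl fun k _ => ?_
    calc _ = u k / m (a k) * (∑ l, if b l = a k then v l else 0) * g k := by
          rw [mul_sum, sum_mul]
          refine sum_congr rfl fun l _ => ?_
          simp only [eq_comm (a := a k)]
          split_ifs <;> ring
      _ = u k * g k := by rw [← h]; exact congrArg (· * g k) (hum k)
  · rw [hsub fun p => u p.1 * v p.2 / m (a p.1) * g p.2, Fintype.sum_prod_type_right]
    refine sum_congr rfl fun l _ => ?_
    calc _ = v l / m (b l) * m (b l) * g l := by
          rw [hm, mul_sum, sum_mul]
          refine sum_congr rfl fun k _ => ?_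
          split_ifs with hk
          · simp only [hk]; ring
          · ring
      _ = v l * g l := by rw [hvm]

lemma mem_convexHull_colSet_iff {ι κ : Type*} [Fintype κ] (S : Matrix ι κ ℝ) (x : ι → ℝ) :
    x ∈ convexHull ℝ (colSet S) ↔
      ∃ w : κ → ℝ, (∀ j, 0 ≤ w j) ∧ ∑ j, w j = 1 ∧ ∀ i, ∑ j, w j * S i j = x i := by
  classical
  constructor
  · intro hx
    have hcol : colSet S = Fintype.linearCombination ℝ (fun j i => S i j) ''
        Set.range fun j : κ => Pi.single j (1 : ℝ) := by
      rw [← Set.range_comp]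
      simp [colSet, Function.comp_def]
    rw [hcol, ← LinearMap.image_convexHull, convexHull_rangle_single_eq_stdSimplex] at hx
    obtain ⟨w, hw, rfl⟩ := hx
    exact ⟨w, hw.1, hw.2, fun i => by simp [Fintype.linearCombination_apply]⟩
  · rintro ⟨w, hw, hw1, hx⟩
    refine mem_convexHull_of_exists_fintype w (fun j i => S i j) hw hw1 (fun j => ⟨j, rfl⟩) ?_
    ext i
    simp [← hx]

/-- A linear map carrying columns of `T` to columns of a slack matrix `S` carries every point of
the affine hull of the columns of `T` with nonnegative image into the convex hull of the columns
of `S`. -/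
lemma IsSlackMatrix.map_mem_convexHull {ι κ ι' κ' : Type*} {S : Matrix ι κ ℝ}
    (hS : IsSlackMatrix S) {T : Matrix ι' κ' ℝ} (f : (ι' → ℝ) →ₗ[ℝ] ι → ℝ)
    (hf : ∀ y ∈ colSet T, f y ∈ colSet S) {x : ι' → ℝ}
    (hx : x ∈ affineSpan ℝ (colSet T)) (hfx : ∀ i, 0 ≤ f x i) :
    f x ∈ convexHull ℝ (colSet S) := by
  rw [hS.2]
  have hsub : f '' colSet T ⊆ colSet S := Set.image_subset_iff.2 hf
  refine ⟨affineSpan_mono ℝ hsub ?_, hfx⟩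
  have h := AffineSubspace.mem_map_of_mem f.toAffineMap hx
  rwa [AffineSubspace.map_span] at h

/-- The weight of a fibre of a `0/1`-valued function is determined by the total weight and the
weighted sum of the function. -/
lemma sum_fiber_eq_of_zero_one {α : Type*} [Fintype α] {a : α → ℝ}
    (ha : ∀ k, a k = 0 ∨ a k = 1) (u : α → ℝ) (c : ℝ) :
    (∑ k, if a k = c then u k else 0) =
      if c = 0 then ∑ k, u k - ∑ k, u k * a k else if c = 1 then ∑ k, u k * a k else 0 := by
  split_ifs with h0 h1
  · rw [← Finset.sum_sub_distrib]
    refine Finset.sum_congr rfl fun k _ => ?_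
    rcases ha k with h | h <;> simp [h, h0]
  · refine Finset.sum_congr rfl fun k _ => ?_
    rcases ha k with h | h <;> simp [h, h1]
  · refine Finset.sum_eq_zero fun k _ => if_neg ?_
    rcases ha k with h | h <;> simpa [h, eq_comm]

/-- If `S1, S2` are nonnegative matrices with designated 0/1 rows `r1, r2`,
each taking both values `0` and `1`, and both `S1` and `S2` are slack matrices, then the
2-product `(S1, r1) ⊗₂ (S2, r2)` is a slack matrix. -/
theorem twoProduct_isSlackMatrix {m1 n1 m2 n2 : ℕ}
    (S1 : Matrix (Fin m1) (Fin n1) ℝ) (S2 : Matrix (Fin m2) (Fin n2) ℝ)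
    (r1 : Fin m1) (r2 : Fin m2)
    (h01₁ : ∀ k, S1 r1 k = 0 ∨ S1 r1 k = 1)
    (h01₂ : ∀ l, S2 r2 l = 0 ∨ S2 r2 l = 1)
    (h0₁ : ∃ k, S1 r1 k = 0) (h1₁ : ∃ k, S1 r1 k = 1)
    (h0₂ : ∃ l, S2 r2 l = 0) (h1₂ : ∃ l, S2 r2 l = 1)
    (hS1 : IsSlackMatrix S1) (hS2 : IsSlackMatrix S2) :
    IsSlackMatrix (twoProduct S1 S2 r1 r2) := by
  classical
  have hnn : ∀ i j, 0 ≤ twoProduct S1 S2 r1 r2 i j := by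
    rintro ((i | i) | i) j
    exacts [hS1.1 _ _, hS2.1 _ _, hS1.1 _ _]
  refine ⟨hnn, Set.Subset.antisymm (Set.subset_inter (convexHull_subset_affineSpan _) ?_) ?_⟩
  · intro x hx
    obtain ⟨w, hw, -, hx⟩ := (mem_convexHull_colSet_iff _ _).1 hx
    intro i
    rw [← hx]
    exact Finset.sum_nonneg fun j _ => mul_nonneg (hw j) (hnn i j)
  rintro x ⟨hx, hx0⟩
  let e1 : Fin m1 → ({i : Fin m1 // i ≠ r1} ⊕ {i : Fin m2 // i ≠ r2}) ⊕ Unit :=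
    fun i => if h : i = r1 then Sum.inr () else Sum.inl (Sum.inl ⟨i, h⟩)
  let e2 : Fin m2 → ({i : Fin m1 // i ≠ r1} ⊕ {i : Fin m2 // i ≠ r2}) ⊕ Unit :=
    fun i => if h : i = r2 then Sum.inr () else Sum.inl (Sum.inr ⟨i, h⟩)
  have hx1 : (fun i => x (e1 i)) ∈ convexHull ℝ (colSet S1) := by
    refine hS1.map_mem_convexHull (LinearMap.funLeft ℝ ℝ e1) ?_ hx fun i => hx0 (e1 i)
    rintro _ ⟨p, rfl⟩
    refine ⟨p.1.1, funext fun i => ?_⟩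
    by_cases h : i = r1 <;> simp [e1, h, LinearMap.funLeft_apply, twoProduct]
  have hx2 : (fun i => x (e2 i)) ∈ convexHull ℝ (colSet S2) := by
    refine hS2.map_mem_convexHull (LinearMap.funLeft ℝ ℝ e2) ?_ hx fun i => hx0 (e2 i)
    rintro _ ⟨p, rfl⟩
    refine ⟨p.1.2, funext fun i => ?_⟩
    by_cases h : i = r2 <;> simp [e2, h, LinearMap.funLeft_apply, twoProduct, p.2]
  obtain ⟨u, hu, hu1, hux⟩ := (mem_convexHull_colSet_iff _ _).1 hx1
  obtain ⟨v, hv, hv1, hvx⟩ := (mem_convexHull_colSet_iff _ _).1 hx2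
  have hr : ∑ k, u k * S1 r1 k = ∑ l, v l * S2 r2 l := by
    rw [hux, hvx]
    simp [e1, e2]
  obtain ⟨w, hw, hwu, hwv⟩ := exists_coupling_of_fiber_sums_eq (S1 r1) (S2 r2) u v hu hv
    (fun c => by
      rw [sum_fiber_eq_of_zero_one h01₁, sum_fiber_eq_of_zero_one h01₂, hu1, hv1, hr])
  refine (mem_convexHull_colSet_iff _ _).2 ⟨w, hw, ?_, ?_⟩
  · simpa [hu1] using hwu 1
  · rintro ((i | i) | i)
    · exact (hwu (S1 i)).trans ((hux i).trans (by simp [e1, i.2]))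
    · exact (hwv (S2 i)).trans ((hvx i).trans (by simp [e2, i.2]))
    · exact (hwu (S1 r1)).trans ((hux r1).trans (by simp [e1]))
end

section
/- Let S1 ∈ ℝ_+^{m1×n1} have a designated 0/1-valued row x1 and S2 ∈ ℝ_+^{m2×n2} a designated 0/1-valued row y1, where each of x1 and y1 takes both values 0 and 1. Suppose the 2-product S = (S1,x1) ⊗₂ (S2,y1) is a slack matrix. Let S1' be the matrix obtained from S1 by appending the row 1 − x1 (the entrywise complement of x1), and let S2' be obtained from S2 by appending the row 1 − y1. Then both S1' and S2' are slack matrices. -/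
/-- The matrix obtained from `S` by appending the entrywise complement `1 - r` of row `r`. -/
def appendComplementRow {m n : ℕ} (S : Matrix (Fin m) (Fin n) ℝ) (r : Fin m) :
    Matrix (Fin m ⊕ Unit) (Fin n) ℝ :=
  fun i j =>
    match i with
    | Sum.inl i' => S i' j
    | Sum.inr _ => 1 - S r j

/-- A nonnegative matrix whose columns are an affine retract of the columns of a slack matrix
is a slack matrix, provided the section sends nonnegative vectors to nonnegative vectors. -/
theorem IsSlackMatrix.of_retract {ι κ ι' κ' : Type*} {S : Matrix ι κ ℝ} {T : Matrix ι' κ' ℝ}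
    (hT : IsSlackMatrix T) (hS : ∀ i j, 0 ≤ S i j)
    (F : (ι → ℝ) →ᵃ[ℝ] (ι' → ℝ)) (G : (ι' → ℝ) →ᵃ[ℝ] (ι → ℝ))
    (hF : Set.MapsTo F (colSet S) (colSet T)) (hG : Set.MapsTo G (colSet T) (colSet S))
    (hGF : ∀ x ∈ colSet S, G (F x) = x)
    (hF_nonneg : ∀ x : ι → ℝ, (∀ i, 0 ≤ x i) → ∀ i, 0 ≤ F x i) :
    IsSlackMatrix S := by
  refine ⟨hS, Set.Subset.antisymm (Set.subset_inter (convexHull_subset_affineSpan _) ?_) ?_⟩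
  · refine convexHull_min ?_ (convex_Ici (0 : ι → ℝ))
    rintro _ ⟨j, rfl⟩ i
    exact hS i j
  · rintro x ⟨hx, hx_nonneg⟩
    have hGFx : G (F x) = x := by
      refine affineSpan_induction (p := fun y => G (F y) = y) hx hGF ?_
      intro c u v w hu hv hw
      have h := (G.comp F).map_vadd w (c • (u -ᵥ v))
      rw [map_smul, AffineMap.linearMap_vsub] at h
      simpa [hu, hv, hw] using h
    have hFx : F x ∈ convexHull ℝ (colSet T) := by
      rw [hT.2]
      refine ⟨?_, hF_nonneg x hx_nonneg⟩
      have h : F x ∈ (affineSpan ℝ (colSet S)).map F := ⟨x, hx, rfl⟩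
      rw [AffineSubspace.map_span] at h
      exact affineSpan_mono ℝ hF.image_subset h
    have h : G (F x) ∈ G '' convexHull ℝ (colSet T) := ⟨_, hFx, rfl⟩
    rw [AffineMap.image_convexHull, hGFx] at h
    exact convexHull_mono hG.image_subset h

theorem IsSlackMatrix.twoProduct_swap {m1 n1 m2 n2 : ℕ}
    {S1 : Matrix (Fin m1) (Fin n1) ℝ} {S2 : Matrix (Fin m2) (Fin n2) ℝ}
    {r1 : Fin m1} {r2 : Fin m2} (hS : IsSlackMatrix (twoProduct S1 S2 r1 r2)) :
    IsSlackMatrix (twoProduct S2 S1 r2 r1) := by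
  have hcol : ∀ {m1 n1 m2 n2 : ℕ} (S1 : Matrix (Fin m1) (Fin n1) ℝ)
      (S2 : Matrix (Fin m2) (Fin n2) ℝ) (r1 : Fin m1) (r2 : Fin m2) i
      (j : {p : Fin n1 × Fin n2 // S1 r1 p.1 = S2 r2 p.2}),
      twoProduct S1 S2 r1 r2 (Sum.map Sum.swap id i) j =
        twoProduct S2 S1 r2 r1 i ⟨j.1.swap, j.2.symm⟩ := by
    rintro _ _ _ _ S1 S2 r1 r2 ((i | i) | i) j
    exacts [rfl, rfl, j.2]
  refine hS.of_retract ?_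
    (LinearMap.funLeft ℝ ℝ (Sum.map Sum.swap id)).toAffineMap
    (LinearMap.funLeft ℝ ℝ (Sum.map Sum.swap id)).toAffineMap ?_ ?_ ?_ fun x hx i => hx _
  · intro i j
    have h := hcol S1 S2 r1 r2 i ⟨j.1.swap, j.2.symm⟩
    exact (hS.1 _ _).trans_eq h
  · rintro _ ⟨j, rfl⟩
    exact ⟨⟨j.1.swap, j.2.symm⟩, funext fun i => (hcol S2 S1 r2 r1 i j).symm⟩
  · rintro _ ⟨j, rfl⟩
    exact ⟨⟨j.1.swap, j.2.symm⟩, funext fun i => (hcol S1 S2 r1 r2 i j).symm⟩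
  · rintro x -
    funext i
    rcases i with (i | i) | i <;> rfl

theorem IsSlackMatrix.appendComplementRow_left {m1 n1 m2 n2 : ℕ}
    {S1 : Matrix (Fin m1) (Fin n1) ℝ} {S2 : Matrix (Fin m2) (Fin n2) ℝ}
    {r1 : Fin m1} {r2 : Fin m2}
    (hS : IsSlackMatrix (twoProduct S1 S2 r1 r2))
    (hS1 : ∀ i j, 0 ≤ S1 i j) (hS2 : ∀ i j, 0 ≤ S2 i j)
    (h01 : ∀ k, S1 r1 k = 0 ∨ S1 r1 k = 1)
    (h0 : ∃ l, S2 r2 l = 0) (h1 : ∃ l, S2 r2 l = 1) :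
    IsSlackMatrix (appendComplementRow S1 r1) := by
  obtain ⟨l0, hl0⟩ := h0
  obtain ⟨l1, hl1⟩ := h1
  let f : (Fin m1 ⊕ Unit → ℝ) →ₗ[ℝ]
      (({i : Fin m1 // i ≠ r1} ⊕ {i : Fin m2 // i ≠ r2}) ⊕ Unit → ℝ) :=
    { toFun := fun x => Sum.elim (Sum.elim (fun i => x (.inl i.1))
        (fun i => x (.inr ()) * S2 i.1 l0 + x (.inl r1) * S2 i.1 l1)) (fun _ => x (.inl r1))
      map_add' := by
        intro x y
        funext i
        rcases i with (i | i) | i <;> simp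
        ring
      map_smul' := by
        intro c x
        funext i
        rcases i with (i | i) | i <;> simp
        ring }
  let g : (({i : Fin m1 // i ≠ r1} ⊕ {i : Fin m2 // i ≠ r2}) ⊕ Unit → ℝ) →ₗ[ℝ]
      (Fin m1 ⊕ Unit → ℝ) :=
    { toFun := fun y => Sum.elim
        (fun i => if h : i = r1 then y (.inr ()) else y (.inl (.inl ⟨i, h⟩)))
        (fun _ => -y (.inr ()))
      map_add' := by
        intro x y
        funext i
        rcases i with i | i
        · by_cases h : i = r1 <;> simp [h]
        · simp
          ring
      map_smul' := by
        intro c x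
        funext i
        rcases i with i | i
        · by_cases h : i = r1 <;> simp [h]
        · simp }
  let G := g.toAffineMap + AffineMap.const ℝ _ (Sum.elim (fun _ => 0) (fun _ => 1))
  have hG_inl : ∀ y i, G y (.inl i) =
      if h : i = r1 then y (.inr ()) else y (.inl (.inl ⟨i, h⟩)) := by
    intro y i
    simp [G, g]
  have hG_inr : ∀ y u, G y (.inr u) = 1 - y (.inr ()) := by
    intro y u
    simp [G, g]
    ring
  refine hS.of_retract ?_ f.toAffineMap G ?_ ?_ ?_ ?_
  · rintro (i | i) j
    · exact hS1 i j
    · rcases h01 j with h | h <;> simp [appendComplementRow, h]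
  · rintro _ ⟨k, rfl⟩
    rcases h01 k with h | h
    · refine ⟨⟨(k, l0), h.trans hl0.symm⟩, ?_⟩
      funext i
      rcases i with (i | i) | i <;> simp [f, twoProduct, appendComplementRow, h]
    · refine ⟨⟨(k, l1), h.trans hl1.symm⟩, ?_⟩
      funext i
      rcases i with (i | i) | i <;> simp [f, twoProduct, appendComplementRow, h]
  · rintro _ ⟨⟨⟨k, l⟩, hkl⟩, rfl⟩
    refine ⟨k, funext fun i => ?_⟩
    rcases i with i | i
    · rw [hG_inl]
      split_ifs with h
      · subst h; rfl
      · rfl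
    · rw [hG_inr]; rfl
  · rintro _ ⟨k, rfl⟩
    funext i
    rcases i with i | i
    · rw [hG_inl]
      split_ifs with h
      · subst h; rfl
      · rfl
    · rw [hG_inr]; rfl
  · rintro x hx ((i | i) | i)
    · exact hx _
    · exact add_nonneg (mul_nonneg (hx _) (hS2 _ _)) (mul_nonneg (hx _) (hS2 _ _))
    · exact hx _

/-- If `S1, S2` are nonnegative matrices with designated 0/1 rows `r1, r2`,
each taking both values `0` and `1`, and the 2-product `(S1, r1) ⊗₂ (S2, r2)` is a slack
matrix, then both `S1' = S1 + (1 - x1)` and `S2' = S2 + (1 - y1)` (the matrices obtained by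
appending the complement of the special row) are slack matrices. -/
theorem twoProduct_slack_factors {m1 n1 m2 n2 : ℕ}
    (S1 : Matrix (Fin m1) (Fin n1) ℝ) (S2 : Matrix (Fin m2) (Fin n2) ℝ)
    (r1 : Fin m1) (r2 : Fin m2)
    (hS1 : ∀ i j, 0 ≤ S1 i j) (hS2 : ∀ i j, 0 ≤ S2 i j)
    (h01₁ : ∀ k, S1 r1 k = 0 ∨ S1 r1 k = 1)
    (h01₂ : ∀ l, S2 r2 l = 0 ∨ S2 r2 l = 1)
    (h0₁ : ∃ k, S1 r1 k = 0) (h1₁ : ∃ k, S1 r1 k = 1)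
    (h0₂ : ∃ l, S2 r2 l = 0) (h1₂ : ∃ l, S2 r2 l = 1)
    (hS : IsSlackMatrix (twoProduct S1 S2 r1 r2)) :
    IsSlackMatrix (appendComplementRow S1 r1) ∧
      IsSlackMatrix (appendComplementRow S2 r2) := by
  exact ⟨hS.appendComplementRow_left hS1 hS2 h01₁ h0₂ h1₂,
    hS.twoProduct_swap.appendComplementRow_left hS2 hS1 h01₂ h0₁ h1₁⟩
end

section
/- Let S ∈ ℝ^{m×n} with n ≥ 1. For X ⊆ [m] and vectors u ∈ ℝ^X, v ∈ ℝ^{[m]\X}, let μ_X(u) be the number of column indices j such that the restriction of column j of S to the rows in X equals u, and let μ(u,v) be the number of j such that column j restricted to X equals u and restricted to [m]\X equals v. Define f(X) = Σ over pairs (u,v) with μ(u,v) > 0 of (μ(u,v)/n)·log( (μ(u,v)/n) / ((μ_X(u)/n)·(μ_{[m]\X}(v)/n)) ). Then f is submodular: for all A, B ⊆ [m], f(A) + f(B) ≥ f(A ∪ B) + f(A ∩ B). -/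
open scoped Classical

/-- `μ_X(u)`: the number of columns of `S` whose restriction to the rows in `X` equals `u`. -/
noncomputable def muRestr {m n : ℕ} (S : Matrix (Fin m) (Fin n) ℝ) (X : Finset (Fin m))
    (u : ↥X → ℝ) : ℕ :=
  Nat.card {j : Fin n // ∀ i : ↥X, S i.1 j = u i}

/-- `μ(u,v)`: the number of columns of `S` whose restriction to the rows in `X` equals `u`
and whose restriction to the rows in `Xᶜ` equals `v`. -/
noncomputable def muJoint {m n : ℕ} (S : Matrix (Fin m) (Fin n) ℝ) (X : Finset (Fin m))
    (u : ↥X → ℝ) (v : ↥Xᶜ → ℝ) : ℕ :=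
  Nat.card {j : Fin n // (∀ i : ↥X, S i.1 j = u i) ∧ (∀ i : ↥Xᶜ, S i.1 j = v i)}

/-- The mutual information `f(X) = I(C_X ; C_{X̄})` of the restrictions to `X` and to its
complement of a uniformly random column `C` of `S`: the sum, over the (finitely many) pairs
`(u,v)` with `μ(u,v) > 0` (i.e. the pairs achieved by some column), of
`(μ(u,v)/n) · log((μ(u,v)/n) / ((μ_X(u)/n) · (μ_{X̄}(v)/n)))`. -/
noncomputable def mutualInfoF {m n : ℕ} (S : Matrix (Fin m) (Fin n) ℝ)
    (X : Finset (Fin m)) : ℝ :=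
  ∑ uv ∈ Finset.image
      (fun j : Fin n => ((fun i : ↥X => S i.1 j), (fun i : ↥Xᶜ => S i.1 j))) Finset.univ,
    ((muJoint S X uv.1 uv.2 : ℝ) / n) *
      Real.log (((muJoint S X uv.1 uv.2 : ℝ) / n) /
        (((muRestr S X uv.1 : ℝ) / n) * ((muRestr S Xᶜ uv.2 : ℝ) / n)))

/-- The number of elements related to `a` by the setoid `r`. -/
noncomputable def Setoid.classCard {α : Type*} [Fintype α] (r : Setoid α) (a : α) : ℕ :=
  (Finset.univ.filter fun b => r b a).card

namespace Setoid

variable {α : Type*} [Fintype α]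

lemma classCard_pos (r : Setoid α) (a : α) : 0 < r.classCard a :=
  Finset.card_pos.2 ⟨a, by simp⟩

lemma classCard_congr (r : Setoid α) {a b : α} (h : r a b) : r.classCard a = r.classCard b := by
  unfold classCard
  congr 1
  ext c
  simp only [Finset.mem_filter, Finset.mem_univ, true_and]
  exact ⟨fun hc => r.trans hc h, fun hc => r.trans hc (r.symm h)⟩

lemma classCard_eq_sum (r : Setoid α) (a : α) :
    (r.classCard a : ℝ) = ∑ b, if r b a then 1 else 0 := by
  simp [classCard]

/-- An intersection of an `r`-class and an `s`-class is at most one `r ⊓ s`-class. -/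
lemma sum_inv_classCard_inf_le_one (r s : Setoid α) (b c : α) :
    ∑ a, (if r b a ∧ s c a then ((r ⊓ s).classCard a : ℝ)⁻¹ else 0) ≤ 1 := by
  by_cases h : ∃ a, r b a ∧ s c a
  · obtain ⟨a₀, hb, hc⟩ := h
    have key : ∀ a, (if r b a ∧ s c a then ((r ⊓ s).classCard a : ℝ)⁻¹ else 0) =
        (if (r ⊓ s) a a₀ then 1 else 0) * ((r ⊓ s).classCard a₀ : ℝ)⁻¹ := by
      intro a
      by_cases ha : (r ⊓ s) a a₀
      · have hra : r b a ∧ s c a :=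
          ⟨r.trans hb (r.symm ha.1), s.trans hc (s.symm ha.2)⟩
        rw [if_pos hra, if_pos ha, one_mul, classCard_congr _ ha]
      · have hra : ¬ (r b a ∧ s c a) := fun h' =>
          ha ⟨r.trans (r.symm h'.1) hb, s.trans (s.symm h'.2) hc⟩
        rw [if_neg hra, if_neg ha, zero_mul]
    rw [Finset.sum_congr rfl fun a _ => key a, ← Finset.sum_mul, ← classCard_eq_sum]
    exact mul_inv_le_one
  · rw [Finset.sum_eq_zero]
    · exact zero_le_one
    · intro a _
      exact if_neg fun h' => h ⟨a, h'⟩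

lemma sum_classCard_mul_div_le (r s w : Setoid α) (hr : r ≤ w) (hs : s ≤ w) :
    ∑ a, (r.classCard a * s.classCard a : ℝ) / ((r ⊓ s).classCard a * w.classCard a) ≤
      Fintype.card α := by
  have expand : ∀ a,
      (r.classCard a * s.classCard a : ℝ) / ((r ⊓ s).classCard a * w.classCard a) =
      ∑ b, ∑ c, (if c ∈ Finset.univ.filter (fun c => w c b) then (w.classCard b : ℝ)⁻¹ else 0) *
        (if r b a ∧ s c a then ((r ⊓ s).classCard a : ℝ)⁻¹ else 0) := by
    intro a
    rw [classCard_eq_sum r, classCard_eq_sum s, Finset.sum_mul_sum, Finset.sum_div]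
    refine Finset.sum_congr rfl fun b _ => ?_
    rw [Finset.sum_div]
    refine Finset.sum_congr rfl fun c _ => ?_
    by_cases hb : r b a
    · by_cases hc : s c a
      · have hw : w c b := w.trans (hs hc) (w.symm (hr hb))
        simp [hb, hc, hw, classCard_congr w (hr hb)]
      · simp [hc]
    · simp [hb]
  rw [Finset.sum_congr rfl fun a _ => expand a, Finset.sum_comm]
  have bound : ∀ b, ∑ a, ∑ c,
      (if c ∈ Finset.univ.filter (fun c => w c b) then (w.classCard b : ℝ)⁻¹ else 0) *
        (if r b a ∧ s c a then ((r ⊓ s).classCard a : ℝ)⁻¹ else 0) ≤ 1 := by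
    intro b
    rw [Finset.sum_comm]
    calc _ ≤ ∑ c, (if w c b then 1 else 0) * (w.classCard b : ℝ)⁻¹ := by
          refine Finset.sum_le_sum fun c _ => ?_
          rw [← Finset.mul_sum]
          by_cases hc : w c b
          · simpa [hc] using mul_le_mul_of_nonneg_left (sum_inv_classCard_inf_le_one r s b c)
              (inv_nonneg.2 (Nat.cast_nonneg (w.classCard b)) : (0 : ℝ) ≤ _)
          · simp [hc]
      _ ≤ 1 := by
          rw [← Finset.sum_mul, ← classCard_eq_sum]
          exact mul_inv_le_one
  simpa using Finset.sum_le_sum fun b (_ : b ∈ Finset.univ) => bound b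

/-- Submodularity of entropy, in terms of the partitions of a finite uniform space. -/
lemma sum_log_classCard_add_le (r s w : Setoid α) (hr : r ≤ w) (hs : s ≤ w) :
    ∑ a, Real.log (r.classCard a) + ∑ a, Real.log (s.classCard a) ≤
      ∑ a, Real.log ((r ⊓ s).classCard a) + ∑ a, Real.log (w.classCard a) := by
  have hpos : ∀ (t : Setoid α) a, (0 : ℝ) < t.classCard a := fun t a =>
    Nat.cast_pos.2 (t.classCard_pos a)
  have h : ∀ a, Real.log (r.classCard a) + Real.log (s.classCard a) -
      (Real.log ((r ⊓ s).classCard a) + Real.log (w.classCard a)) ≤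
      (r.classCard a * s.classCard a : ℝ) / ((r ⊓ s).classCard a * w.classCard a) - 1 := by
    intro a
    have h1 := hpos r a
    have h2 := hpos s a
    have h3 := hpos (r ⊓ s) a
    have h4 := hpos w a
    rw [← Real.log_mul h1.ne' h2.ne', ← Real.log_mul h3.ne' h4.ne',
      ← Real.log_div (by positivity) (by positivity)]
    exact Real.log_le_sub_one_of_pos (by positivity)
  have hsum := Finset.sum_le_sum fun a (_ : a ∈ Finset.univ) => h a
  simp only [Finset.sum_sub_distrib, Finset.sum_add_distrib] at hsum
  have hcard := sum_classCard_mul_div_le r s w hr hs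
  simp only [Finset.sum_const, Finset.card_univ, nsmul_eq_mul, mul_one] at hsum
  linarith

end Setoid

/-- Columns are related when they agree on all rows in `X`. -/
def agreeOn {ι α β : Type*} (S : Matrix ι α β) (X : Finset ι) : Setoid α where
  r j k := ∀ i ∈ X, S i j = S i k
  iseqv := ⟨fun _ _ _ => rfl, fun h i hi => (h i hi).symm,
    fun h h' i hi => (h i hi).trans (h' i hi)⟩

lemma agreeOn_iff {ι α β : Type*} {S : Matrix ι α β} {X : Finset ι} {j k : α} :
    agreeOn S X j k ↔ ∀ i ∈ X, S i j = S i k :=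
  Iff.rfl

lemma agreeOn_union {ι α β : Type*} [DecidableEq ι] (S : Matrix ι α β) (X Y : Finset ι) :
    agreeOn S (X ∪ Y) = agreeOn S X ⊓ agreeOn S Y := by
  ext j k
  simp [Setoid.inf_iff_and, agreeOn_iff, or_imp, forall_and]

lemma agreeOn_anti {ι α β : Type*} (S : Matrix ι α β) {X Y : Finset ι} (h : X ⊆ Y) :
    agreeOn S Y ≤ agreeOn S X :=
  Setoid.le_def.2 fun hjk i hi => hjk i (h hi)

lemma sum_log_classCard_agreeOn_add_le {ι α β : Type*} [DecidableEq ι] [Fintype α] (S : Matrix ι α β)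
    (X Y : Finset ι) :
    ∑ j, Real.log ((agreeOn S X).classCard j) + ∑ j, Real.log ((agreeOn S Y).classCard j) ≤
      ∑ j, Real.log ((agreeOn S (X ∪ Y)).classCard j) +
        ∑ j, Real.log ((agreeOn S (X ∩ Y)).classCard j) := by
  rw [agreeOn_union]
  exact Setoid.sum_log_classCard_add_le _ _ _ (agreeOn_anti S Finset.inter_subset_left)
    (agreeOn_anti S Finset.inter_subset_right)

lemma muRestr_column {m n : ℕ} (S : Matrix (Fin m) (Fin n) ℝ) (X : Finset (Fin m))
    (j : Fin n) : muRestr S X (fun i => S i.1 j) = (agreeOn S X).classCard j := by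
  simp only [muRestr, Setoid.classCard, Nat.card_eq_fintype_card, Fintype.card_subtype]
  congr 1
  ext k
  simp [agreeOn_iff]

lemma muJoint_column {m n : ℕ} (S : Matrix (Fin m) (Fin n) ℝ) (X : Finset (Fin m))
    (j : Fin n) :
    muJoint S X (fun i => S i.1 j) (fun i => S i.1 j) =
      (agreeOn S Finset.univ).classCard j := by
  have h : agreeOn S Finset.univ = agreeOn S X ⊓ agreeOn S Xᶜ := by
    rw [← agreeOn_union, Finset.union_compl]
  rw [h]
  simp only [muJoint, Setoid.classCard, Nat.card_eq_fintype_card, Fintype.card_subtype]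
  congr 1
  ext k
  simp [Setoid.inf_iff_and, agreeOn_iff]

lemma muJoint_eq_card_filter {m n : ℕ} (S : Matrix (Fin m) (Fin n) ℝ) (X : Finset (Fin m))
    (uv : (↥X → ℝ) × (↥Xᶜ → ℝ)) :
    muJoint S X uv.1 uv.2 = (Finset.univ.filter fun j : Fin n =>
      ((fun i : ↥X => S i.1 j), (fun i : ↥Xᶜ => S i.1 j)) = uv).card := by
  simp only [muJoint, Nat.card_eq_fintype_card, Fintype.card_subtype]
  congr 1
  ext k
  simp [Prod.ext_iff, funext_iff]

lemma mutualInfoF_eq {m n : ℕ} (S : Matrix (Fin m) (Fin n) ℝ) (hn : 1 ≤ n)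
    (X : Finset (Fin m)) :
    mutualInfoF S X = (n : ℝ)⁻¹ * (∑ j, Real.log ((agreeOn S Finset.univ).classCard j) +
      n * Real.log n - ∑ j, Real.log ((agreeOn S X).classCard j) -
        ∑ j, Real.log ((agreeOn S Xᶜ).classCard j)) := by
  have hn' : (0 : ℝ) < n := Nat.cast_pos.2 hn
  have hsum := Finset.sum_comp (s := (Finset.univ : Finset (Fin n)))
    (fun uv : (↥X → ℝ) × (↥Xᶜ → ℝ) =>
      Real.log (((muJoint S X uv.1 uv.2 : ℝ) / n) /
        (((muRestr S X uv.1 : ℝ) / n) * ((muRestr S Xᶜ uv.2 : ℝ) / n))))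
    (fun j : Fin n => ((fun i : ↥X => S i.1 j), (fun i : ↥Xᶜ => S i.1 j)))
  have hcolumn : mutualInfoF S X = (n : ℝ)⁻¹ * ∑ j : Fin n,
      Real.log ((((agreeOn S Finset.univ).classCard j : ℝ) / n) /
        ((((agreeOn S X).classCard j : ℝ) / n) * (((agreeOn S Xᶜ).classCard j : ℝ) / n))) := by
    simp only [muJoint_column, muRestr_column] at hsum
    rw [hsum, mutualInfoF, Finset.mul_sum]
    refine Finset.sum_congr rfl fun uv _ => ?_
    rw [← muJoint_eq_card_filter, nsmul_eq_mul]
    ring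
  have hlog : ∀ j : Fin n,
      Real.log ((((agreeOn S Finset.univ).classCard j : ℝ) / n) /
        ((((agreeOn S X).classCard j : ℝ) / n) * (((agreeOn S Xᶜ).classCard j : ℝ) / n))) =
      Real.log ((agreeOn S Finset.univ).classCard j) + Real.log n -
        Real.log ((agreeOn S X).classCard j) - Real.log ((agreeOn S Xᶜ).classCard j) := by
    intro j
    have h1 : (0 : ℝ) < (agreeOn S Finset.univ).classCard j :=
      Nat.cast_pos.2 (Setoid.classCard_pos _ j)
    have h2 : (0 : ℝ) < (agreeOn S X).classCard j := Nat.cast_pos.2 (Setoid.classCard_pos _ j)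
    have h3 : (0 : ℝ) < (agreeOn S Xᶜ).classCard j := Nat.cast_pos.2 (Setoid.classCard_pos _ j)
    rw [Real.log_div (by positivity) (by positivity), Real.log_mul (by positivity) (by positivity),
      Real.log_div h1.ne' hn'.ne', Real.log_div h2.ne' hn'.ne', Real.log_div h3.ne' hn'.ne']
    ring
  rw [hcolumn, Finset.sum_congr rfl fun j _ => hlog j]
  simp [Finset.sum_sub_distrib, Finset.sum_add_distrib]

/-- The mutual-information set function `f` associated to a matrix
`S ∈ ℝ^{m×n}` (with `n ≥ 1`) is submodular: `f(A) + f(B) ≥ f(A ∪ B) + f(A ∩ B)`. -/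
theorem mutualInfoF_submodular {m n : ℕ} (S : Matrix (Fin m) (Fin n) ℝ) (hn : 1 ≤ n)
    (A B : Finset (Fin m)) :
    mutualInfoF S (A ∪ B) + mutualInfoF S (A ∩ B) ≤ mutualInfoF S A + mutualInfoF S B := by
  simp only [mutualInfoF_eq S hn, ← mul_add]
  refine mul_le_mul_of_nonneg_left ?_ (inv_nonneg.2 (Nat.cast_nonneg n))
  have h := sum_log_classCard_agreeOn_add_le S A B
  have hc := sum_log_classCard_agreeOn_add_le S Aᶜ Bᶜ
  rw [← Finset.compl_inter, ← Finset.compl_union] at hc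
  linarith
end

section
/- Let S ∈ ℝ^{m×n} with n ≥ 1 and let X be a nonempty proper subset of [m], with complement X̄ = [m]\X. Then S is a 1-product with respect to the partition (X, X̄) if and only if for all u ∈ ℝ^X and v ∈ ℝ^{X̄} one has n·μ(u,v) = μ_X(u)·μ_{X̄}(v), where μ_X(u) is the number of column indices j such that column j of S restricted to the rows in X equals u, μ_{X̄}(v) is defined analogously, and μ(u,v) is the number of j such that column j restricted to X equals u and restricted to X̄ equals v. -/
/-- Maps with equinumerous fibers differ by a bijection of their domains. -/
theorem exists_equiv_of_card_fiber_eq {α β γ : Type*} [Finite α] [Finite β]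
    (f : α → γ) (g : β → γ)
    (h : ∀ c, Nat.card {a // f a = c} = Nat.card {b // g b = c}) :
    ∃ e : α ≃ β, ∀ a, g (e a) = f a := by
  let e (c : γ) : {a // f a = c} ≃ {b // g b = c} := Classical.choice (Finite.card_eq.mp (h c))
  refine ⟨(Equiv.sigmaFiberEquiv f).symm.trans
    ((Equiv.sigmaCongrRight e).trans (Equiv.sigmaFiberEquiv g)), fun a => ?_⟩
  exact (e (f a) ⟨a, rfl⟩).2

/-- Fibers of the composition of `f` with the first projection. -/
theorem card_fiber_comp_fst {α β γ : Type*} (f : α → γ) (c : γ) :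
    Nat.card {p : α × β // f p.1 = c} = Nat.card {a // f a = c} * Nat.card β := by
  rw [← Nat.card_prod]
  exact Nat.card_congr
    { toFun p := (⟨p.1.1, p.2⟩, p.1.2)
      invFun q := ⟨(q.1.1, q.2), q.1.2⟩ }

/-- Fibers of the composition of `f` with the second projection. -/
theorem card_fiber_comp_snd {α β γ : Type*} (f : β → γ) (c : γ) :
    Nat.card {p : α × β // f p.2 = c} = Nat.card α * Nat.card {b // f b = c} := by
  rw [← Nat.card_prod]
  exact Nat.card_congr
    { toFun p := (p.1.1, ⟨p.1.2, p.2⟩)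
      invFun q := ⟨(q.1, q.2.1), q.2.2⟩ }

/-- The fibers of a product map are the products of the fibers. -/
theorem card_fiber_prod {α β γ δ : Type*} (f : α → γ) (g : β → δ) (c : γ) (d : δ) :
    Nat.card {p : α × β // f p.1 = c ∧ g p.2 = d} =
      Nat.card {a // f a = c} * Nat.card {b // g b = d} := by
  rw [← Nat.card_prod]
  exact Nat.card_congr
    { toFun p := (⟨p.1.1, p.2.1⟩, ⟨p.1.2, p.2.2⟩)
      invFun q := ⟨(q.1.1, q.2.1), q.1.2, q.2.2⟩ }

/-- The size of the domain is the sum of the fiber sizes over the range. -/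
theorem card_eq_sum_card_fiber {α γ : Type*} [Finite α] (f : α → γ) [Fintype (Set.range f)] :
    Nat.card α = ∑ c : Set.range f, Nat.card {a // f a = c} := by
  rw [← Nat.card_sigma, Nat.card_congr (Equiv.sigmaFiberEquiv (Set.rangeFactorization f)).symm]
  simp only [Nat.card_sigma, Subtype.ext_iff, Set.rangeFactorization_coe]

/-- If `d` divides all fiber sizes of `f`, some map has all fibers `d` times smaller. -/
theorem exists_card_fiber_mul_eq {α γ : Type*} [Finite α] (f : α → γ) {N d : ℕ} (hd : 0 < d)
    (hN : N * d = Nat.card α) (h : ∀ c, d ∣ Nat.card {a // f a = c}) :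
    ∃ F : Fin N → γ, ∀ c, Nat.card {i // F i = c} * d = Nat.card {a // f a = c} := by
  classical
  have := Fintype.ofFinite (Set.range f)
  choose p hp using h
  have hT : Nat.card (Fin N) = Nat.card (Σ c : Set.range f, Fin (p c)) := by
    apply Nat.eq_of_mul_eq_mul_right hd
    rw [Nat.card_fin, hN, card_eq_sum_card_fiber f, Nat.card_sigma, Finset.sum_mul]
    simp [hp, mul_comm]
  let e : Fin N ≃ Σ c : Set.range f, Fin (p c) := Classical.choice (Finite.card_eq.mp hT)
  refine ⟨fun i => (e i).1, fun c => ?_⟩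
  rw [Nat.card_congr (e.subtypeEquiv (q := fun x => (x.1 : γ) = c) fun _ => Iff.rfl), hp c,
    mul_comm]
  congr 1
  by_cases hc : c ∈ Set.range f
  · rw [Nat.card_congr (Equiv.subtypeEquivRight (q := fun x => x.1 = ⟨c, hc⟩)
      fun _ => by simp [Subtype.ext_iff]),
      Nat.card_congr (Equiv.sigmaSubtype (⟨c, hc⟩ : Set.range f)), Nat.card_fin]
  · have hp0 : p c = 0 := by
      have : IsEmpty {a // f a = c} := ⟨fun a => hc ⟨a.1, a.2⟩⟩
      have h0 := hp c
      rw [Nat.card_of_isEmpty] at h0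
      exact (Nat.mul_eq_zero.mp h0.symm).resolve_left hd.ne'
    have : IsEmpty {x : Σ c : Set.range f, Fin (p c) // (x.1 : γ) = c} :=
      ⟨fun x => hc (x.2 ▸ x.1.1.2)⟩
    rw [Nat.card_of_isEmpty, hp0]

/-- Two maps on a finite nonempty set that are independent for the uniform distribution
factor through the coordinates of a product decomposition of their domain. -/
theorem exists_prod_equiv_of_card_fiber_mul {α γ δ : Type*} [Finite α] [Nonempty α]
    (f : α → γ) (g : α → δ)
    (h : ∀ c d, Nat.card α * Nat.card {a // f a = c ∧ g a = d} =
      Nat.card {a // f a = c} * Nat.card {a // g a = d}) :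
    ∃ (n₁ n₂ : ℕ) (F : Fin n₁ → γ) (G : Fin n₂ → δ) (σ : α ≃ Fin n₁ × Fin n₂),
      ∀ a, f a = F (σ a).1 ∧ g a = G (σ a).2 := by
  classical
  have := Fintype.ofFinite (Set.range f)
  have hα : 0 < Nat.card α := Nat.card_pos
  let D := Finset.univ.gcd fun c : Set.range f => Nat.card {a // f a = c}
  have hDf (c : γ) : D ∣ Nat.card {a // f a = c} := by
    by_cases hc : c ∈ Set.range f
    · exact Finset.gcd_dvd (f := fun c : Set.range f => Nat.card {a // f a = c})
        (Finset.mem_univ ⟨c, hc⟩)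
    · have : IsEmpty {a // f a = c} := ⟨fun a => hc ⟨a.1, a.2⟩⟩
      simp
  obtain ⟨N, hN⟩ : D ∣ Nat.card α := by
    rw [card_eq_sum_card_fiber f]
    exact Finset.dvd_sum fun c _ => hDf c
  have hD : 0 < D := Nat.pos_of_mul_pos_right (hN ▸ hα)
  have hN0 : 0 < N := Nat.pos_of_mul_pos_left (hN ▸ hα)
  have hNg (d : δ) : N ∣ Nat.card {a // g a = d} := by
    apply Nat.dvd_of_mul_dvd_mul_left hD
    rw [← hN]
    have := Finset.dvd_gcd (s := Finset.univ)
      (f := fun c : Set.range f => Nat.card {a // f a = c} * Nat.card {a // g a = d})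
      fun c _ => Dvd.intro _ (h c d)
    simpa [Finset.gcd_mul_right, D] using this
  obtain ⟨F, hF⟩ := exists_card_fiber_mul_eq f hD (N := N) (by rw [hN, mul_comm]) hDf
  obtain ⟨G, hG⟩ := exists_card_fiber_mul_eq g hN0 (N := D) hN.symm hNg
  obtain ⟨σ, hσ⟩ := exists_equiv_of_card_fiber_eq (fun a => (f a, g a))
    (fun p : Fin N × Fin D => (F p.1, G p.2)) (by
      rintro ⟨c, d⟩
      simp only [Prod.mk.injEq]
      rw [card_fiber_prod]
      apply Nat.eq_of_mul_eq_mul_left hα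
      rw [h, ← hF, ← hG, hN]
      ring)
  exact ⟨N, D, F, G, σ, fun a => by simpa [eq_comm] using hσ a⟩


/-- `S` is a 1-product with respect to the partition `(X, Xᶜ)` of its row set: there are
`n1, n2` with `n = n1·n2`, matrices `S1` (rows indexed by `X`, `n1` columns) and `S2` (rows
indexed by `Xᶜ`, `n2` columns), and a bijection `σ : [n] → [n1]×[n2]` such that every column
`j` of `S` restricted to `X` is the `σ(j)₁`-th column of `S1`, and restricted to `Xᶜ` is the
`σ(j)₂`-th column of `S2`. -/
def IsOneProductWith {m n : ℕ} (S : Matrix (Fin m) (Fin n) ℝ) (X : Finset (Fin m)) : Prop :=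
  ∃ (n1 n2 : ℕ) (S1 : Matrix ↥X (Fin n1) ℝ) (S2 : Matrix ↥Xᶜ (Fin n2) ℝ)
    (σ : Fin n ≃ Fin n1 × Fin n2),
    n = n1 * n2 ∧
      ∀ j : Fin n, (∀ i : ↥X, S i.1 j = S1 i (σ j).1) ∧ (∀ i : ↥Xᶜ, S i.1 j = S2 i (σ j).2)

/-- For a matrix `S ∈ ℝ^{m×n}` with `n ≥ 1` and a nonempty proper subset `X`
of the row set, `S` is a 1-product with respect to `(X, Xᶜ)` if and only if
`n·μ(u,v) = μ_X(u)·μ_{Xᶜ}(v)` for all `u ∈ ℝ^X` and `v ∈ ℝ^{Xᶜ}` — i.e. iff the restrictions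
of a uniformly random column of `S` to `X` and to `Xᶜ` are independent. -/
theorem isOneProductWith_iff_independent {m n : ℕ} (S : Matrix (Fin m) (Fin n) ℝ)
    (hn : 1 ≤ n) (X : Finset (Fin m)) (hX : X.Nonempty) (hXproper : X ≠ Finset.univ) :
    IsOneProductWith S X ↔
      ∀ (u : ↥X → ℝ) (v : ↥Xᶜ → ℝ),
        n * muJoint S X u v = muRestr S X u * muRestr S Xᶜ v := by
  let f (j : Fin n) (i : ↥X) : ℝ := S i.1 j
  let g (j : Fin n) (i : ↥Xᶜ) : ℝ := S i.1 j
  have hf (u) : muRestr S X u = Nat.card {j // f j = u} := by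
    simp only [muRestr, funext_iff, f]
  have hg (v) : muRestr S Xᶜ v = Nat.card {j // g j = v} := by
    simp only [muRestr, funext_iff, g]
  have hfg (u v) : muJoint S X u v = Nat.card {j // f j = u ∧ g j = v} := by
    simp only [muJoint, funext_iff, f, g]
  simp only [hf, hg, hfg]
  constructor
  · rintro ⟨n1, n2, S1, S2, σ, hn12, hσ⟩ u v
    have hf' (j) : f j = S1.col (σ j).1 := funext (hσ j).1
    have hg' (j) : g j = S2.col (σ j).2 := funext (hσ j).2
    rw [Nat.card_congr (σ.subtypeEquiv (q := fun p => S1.col p.1 = u ∧ S2.col p.2 = v)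
        fun j => by rw [hf', hg']),
      Nat.card_congr (σ.subtypeEquiv (q := fun p => S1.col p.1 = u) fun j => by rw [hf']),
      Nat.card_congr (σ.subtypeEquiv (q := fun p => S2.col p.2 = v) fun j => by rw [hg']),
      card_fiber_prod, card_fiber_comp_fst, card_fiber_comp_snd, Nat.card_fin, Nat.card_fin, hn12]
    ring
  · intro h
    have : Nonempty (Fin n) := ⟨⟨0, hn⟩⟩
    obtain ⟨n1, n2, F, G, σ, hσ⟩ := exists_prod_equiv_of_card_fiber_mul f g (by simpa using h)
    refine ⟨n1, n2, fun i k => F k i, fun i k => G k i, σ, ?_, fun j =>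
      ⟨congrFun (hσ j).1, congrFun (hσ j).2⟩⟩
    simpa using Nat.card_congr σ
end

section
/- Let M be a k × ℓ matrix with nonnegative integer entries, and suppose M = u·vᵀ for some vectors u ∈ ℝ_+^k and v ∈ ℝ_+^ℓ with nonnegative real entries. Then there exist vectors ū ∈ ℤ_{≥0}^k and v̄ ∈ ℤ_{≥0}^ℓ with nonnegative integer entries such that M = ū·v̄ᵀ. -/
/-- A matrix of natural numbers whose `2 × 2` minors all vanish is an outer product of two vectors
of natural numbers. -/
theorem exists_nat_outer_product_of_minors_eq_zero {ι κ : Type*} [Fintype κ] (N : ι → κ → ℕ)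
    (hN : ∀ i i' j j', N i j * N i' j' = N i j' * N i' j) :
    ∃ (a : ι → ℕ) (b : κ → ℕ), ∀ i j, N i j = a i * b j := by
  by_cases h0 : ∀ i j, N i j = 0
  · exact ⟨0, 0, fun i j => by simp [h0 i j]⟩
  push Not at h0
  obtain ⟨i₀, j₀, h⟩ := h0
  have hdvd : ∀ j, Finset.univ.gcd (N i₀) ∣ N i₀ j := fun j => Finset.gcd_dvd (Finset.mem_univ j)
  have hpos : 0 < Finset.univ.gcd (N i₀) :=
    Nat.pos_of_dvd_of_pos (hdvd j₀) (Nat.pos_of_ne_zero h)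
  choose b hb using hdvd
  refine ⟨fun i => Finset.univ.gcd (N i), b, fun i j => ?_⟩
  have hgcd : N i j * Finset.univ.gcd (N i₀) = Finset.univ.gcd (N i) * N i₀ j := by
    have hl := Finset.gcd_mul_left (s := Finset.univ) (f := N i₀) (a := N i j)
    have hr := Finset.gcd_mul_right (s := Finset.univ) (f := N i) (a := N i₀ j)
    rw [normalize_eq] at hl hr
    rw [← hl, ← hr]
    exact Finset.gcd_congr rfl fun j' _ => hN i i₀ j j'
  apply Nat.eq_of_mul_eq_mul_right hpos
  rw [hgcd, hb j]
  ring

/-- If a matrix `M` with nonnegative integer entries admits a rank-one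
factorization `M = u·vᵀ` with nonnegative real vectors `u, v`, then it admits a rank-one
factorization `M = ū·v̄ᵀ` with nonnegative integer vectors `ū, v̄`. -/
theorem rank_one_integer_factorization {k l : ℕ}
    (M : Matrix (Fin k) (Fin l) ℝ)
    (hMint : ∀ i j, ∃ z : ℕ, M i j = (z : ℝ))
    (u : Fin k → ℝ) (v : Fin l → ℝ)
    (hu : ∀ i, 0 ≤ u i) (hv : ∀ j, 0 ≤ v j)
    (hM : ∀ i j, M i j = u i * v j) :
    ∃ (ub : Fin k → ℕ) (vb : Fin l → ℕ), ∀ i j, M i j = (ub i : ℝ) * (vb j : ℝ) := by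
  choose N hN using hMint
  obtain ⟨a, b, hab⟩ := exists_nat_outer_product_of_minors_eq_zero N fun i i' j j' => by
    have : (N i j : ℝ) * N i' j' = N i j' * N i' j := by
      simp only [← hN, hM]
      ring
    exact_mod_cast this
  exact ⟨a, b, fun i j => by rw [hN, hab, Nat.cast_mul]⟩
end

section
/- Let S ∈ ℝ^{m×n} and suppose S is a 1-product with respect to some partition of [m] into two nonempty parts. Then there exists a partition {X1, …, Xt} of [m] with t ≥ 2 such that: (1) for each i ∈ [t], S is a 1-product with respect to (Xi, [m]\Xi); (2) for each i ∈ [t] and each nonempty proper subset X ⊊ Xi, S is not a 1-product with respect to (X, [m]\X); and (3) any partition of [m] satisfying (1) and (2) equals {X1, …, Xt}. -/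
/-- `P` is a partition `{X1, …, Xt}` of the row set `[m]` of `S` such that: each part is
nonempty, (1) `S` is a 1-product with respect to `(Xi, [m]\Xi)` for each part `Xi`, and
(2) for each part `Xi` and each nonempty proper subset `X ⊊ Xi`, `S` is not a 1-product with
respect to `(X, [m]\X)`. -/
def IsFinestProductPartition {m n : ℕ} (S : Matrix (Fin m) (Fin n) ℝ)
    (P : Finset (Finset (Fin m))) : Prop :=
  (∀ X ∈ P, X.Nonempty) ∧
    (∀ X ∈ P, ∀ Y ∈ P, X ≠ Y → Disjoint X Y) ∧
    P.biUnion id = Finset.univ ∧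
    (∀ X ∈ P, IsOneProductWith S X) ∧
    (∀ X ∈ P, ∀ Y : Finset (Fin m), Y ⊆ X → Y.Nonempty → Y ≠ X → ¬ IsOneProductWith S Y)

/-- If `f` and `g` are independent for the uniform distribution on `J`, then `J` is a product
on which `f` depends only on the first coordinate and `g` only on the second. -/
theorem exists_equiv_prod_of_card_mul {J U V : Type*} [Fintype J] [Fintype U] [Fintype V]
    [DecidableEq U] [DecidableEq V] (f : J → U) (g : J → V)
    (h : ∀ u v, Fintype.card J * Fintype.card {j // (f j, g j) = (u, v)} =
      Fintype.card {j // f j = u} * Fintype.card {j // g j = v}) :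
    ∃ (n1 n2 : ℕ) (p : Fin n1 → U) (q : Fin n2 → V) (σ : J ≃ Fin n1 × Fin n2),
      ∀ j, f j = p (σ j).1 ∧ g j = q (σ j).2 := by
  classical
  rcases isEmpty_or_nonempty J with hJ | ⟨⟨j0⟩⟩
  · exact ⟨0, 0, Fin.elim0, Fin.elim0, Equiv.equivOfIsEmpty _ _, fun j => hJ.elim j⟩
  have hn : 0 < Fintype.card J := Fintype.card_pos_iff.2 ⟨j0⟩
  set r : U → ℕ := fun u => Fintype.card {j // f j = u}
  set s : V → ℕ := fun v => Fintype.card {j // g j = v}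
  set d : ℕ := Finset.univ.gcd r
  have hd0 : 0 < d := by
    refine Nat.pos_of_ne_zero fun h0 => ?_
    have h1 : r (f j0) = 0 := Finset.gcd_eq_zero_iff.1 h0 _ (Finset.mem_univ _)
    exact (Fintype.card_pos_iff.2 ⟨⟨j0, rfl⟩⟩ : 0 < r (f j0)).ne' h1
  have hdvd : ∀ v, Fintype.card J ∣ d * s v := by
    intro v
    have h1 : Fintype.card J ∣ Finset.univ.gcd (fun u => r u * s v) :=
      Finset.dvd_gcd fun u _ => ⟨_, (h u v).symm⟩
    rwa [Finset.gcd_mul_right, normalize_eq] at h1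
  choose a ha using fun u => (Finset.gcd_dvd (Finset.mem_univ u) : d ∣ r u)
  choose b hb using hdvd
  have hab : ∀ w : U × V,
      Fintype.card {j // (f j, g j) = w} = Fintype.card (Fin (a w.1) × Fin (b w.2)) := by
    rintro ⟨u, v⟩
    rw [Fintype.card_prod, Fintype.card_fin, Fintype.card_fin]
    apply Nat.eq_of_mul_eq_mul_left (Nat.mul_pos hd0 hn)
    calc _ = d * (r u * s v) := by rw [← h u v, mul_assoc]
      _ = d * a u * (d * s v) := by rw [ha u]; ring
      _ = _ := by rw [hb v]; ring
  let e : J ≃ (Σ u, Fin (a u)) × (Σ v, Fin (b v)) :=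
    ((Equiv.sigmaFiberEquiv fun j => (f j, g j)).symm.trans
      (Equiv.sigmaCongrRight fun w => Fintype.equivOfCardEq (hab w))).trans
      { toFun := fun x => (⟨x.1.1, x.2.1⟩, ⟨x.1.2, x.2.2⟩)
        invFun := fun y => ⟨(y.1.1, y.2.1), (y.1.2, y.2.2)⟩
        left_inv := fun _ => rfl
        right_inv := fun _ => rfl }
  let e1 := Fintype.equivFin (Σ u, Fin (a u))
  let e2 := Fintype.equivFin (Σ v, Fin (b v))
  refine ⟨_, _, fun k => (e1.symm k).1, fun k => (e2.symm k).1, e.trans (e1.prodCongr e2),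
    fun j => ?_⟩
  simp [e]

/-- The number of columns of `S` that agree with `x` on the rows in `A`. -/
noncomputable def agreeCount {m n : ℕ} (S : Matrix (Fin m) (Fin n) ℝ) (A : Finset (Fin m))
    (x : Fin m → ℝ) : ℕ :=
  Nat.card {j : Fin n // ∀ i ∈ A, S i j = x i}

theorem agreeCount_empty {m n : ℕ} (S : Matrix (Fin m) (Fin n) ℝ) (x : Fin m → ℝ) :
    agreeCount S ∅ x = n := by
  simp [agreeCount]

theorem IsOneProductWith.mul_agreeCount_union {m n : ℕ} {S : Matrix (Fin m) (Fin n) ℝ}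
    {X : Finset (Fin m)} (h : IsOneProductWith S X) {A B : Finset (Fin m)} (hA : A ⊆ X)
    (hB : B ⊆ Xᶜ) (x : Fin m → ℝ) :
    n * agreeCount S (A ∪ B) x = agreeCount S A x * agreeCount S B x := by
  obtain ⟨n1, n2, S1, S2, σ, hn, h⟩ := h
  have key : ∀ A ⊆ X, ∀ B ⊆ Xᶜ, agreeCount S (A ∪ B) x =
      Nat.card {k // ∀ i : ↥X, i.1 ∈ A → S1 i k = x i} *
        Nat.card {k // ∀ i : ↥Xᶜ, i.1 ∈ B → S2 i k = x i} := by
    intro A hA B hB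
    rw [← Nat.card_prod]
    refine Nat.card_congr ((σ.subtypeEquiv fun j => ?_).trans
      (Equiv.subtypeProdEquivProd
        (p := fun k => ∀ i : ↥X, i.1 ∈ A → S1 i k = x i)
        (q := fun k => ∀ i : ↥Xᶜ, i.1 ∈ B → S2 i k = x i)))
    constructor
    · intro hj
      exact ⟨fun i hi => by rw [← (h j).1 i, hj _ (Finset.mem_union_left _ hi)],
        fun i hi => by rw [← (h j).2 i, hj _ (Finset.mem_union_right _ hi)]⟩
    · rintro ⟨h1, h2⟩ i hi
      rcases Finset.mem_union.1 hi with hi | hi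
      · rw [(h j).1 ⟨i, hA hi⟩, h1 ⟨i, hA hi⟩ hi]
      · rw [(h j).2 ⟨i, hB hi⟩, h2 ⟨i, hB hi⟩ hi]
  have h1 := key A hA ∅ (Finset.empty_subset _)
  have h2 := key ∅ (Finset.empty_subset _) B hB
  rw [Finset.union_empty] at h1
  rw [Finset.empty_union] at h2
  rw [key A hA B hB, h1, h2]
  simp only [Finset.notMem_empty, false_imp_iff, implies_true, Nat.card_eq_fintype_card,
    Fintype.card_subtype_true, Fintype.card_fin]
  rw [hn]
  ring

theorem isOneProductWith_of_mul_agreeCount {m n : ℕ} {S : Matrix (Fin m) (Fin n) ℝ}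
    {X : Finset (Fin m)}
    (h : ∀ x, n * agreeCount S Finset.univ x = agreeCount S X x * agreeCount S Xᶜ x) :
    IsOneProductWith S X := by
  classical
  let f : Fin n → ↥X → ℝ := fun j i => S i j
  let g : Fin n → ↥Xᶜ → ℝ := fun j i => S i j
  obtain ⟨n1, n2, p, q, σ, hσ⟩ := exists_equiv_prod_of_card_mul
    (Set.rangeFactorization f) (Set.rangeFactorization g) (by
      rintro ⟨_, j1, rfl⟩ ⟨_, j2, rfl⟩
      have hx := h fun i => if i ∈ X then S i j1 else S i j2
      simp only [← Nat.card_eq_fintype_card]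
      rw [Nat.card_eq_fintype_card (α := Fin n), Fintype.card_fin]
      convert hx using 2
      · refine Nat.card_congr (Equiv.subtypeEquivRight fun j => ?_)
        simp only [Prod.mk.injEq, Subtype.ext_iff, Set.rangeFactorization_coe, funext_iff, f, g,
          Subtype.forall, Finset.mem_compl, Finset.mem_univ, true_imp_iff]
        grind
      · refine Nat.card_congr (Equiv.subtypeEquivRight fun j => ?_)
        simp only [Subtype.ext_iff, Set.rangeFactorization_coe, funext_iff, f, Subtype.forall]
        grind
      · refine Nat.card_congr (Equiv.subtypeEquivRight fun j => ?_)
        simp only [Subtype.ext_iff, Set.rangeFactorization_coe, funext_iff, g, Subtype.forall,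
          Finset.mem_compl]
        grind)
  refine ⟨n1, n2, fun i k => (p k).1 i, fun i k => (q k).1 i, σ, ?_, fun j => ⟨fun i => ?_,
    fun i => ?_⟩⟩
  · simpa using Fintype.card_congr σ
  · exact congrFun (congrArg Subtype.val (hσ j).1) i
  · exact congrFun (congrArg Subtype.val (hσ j).2) i

theorem isOneProductWith_univ {m n : ℕ} (S : Matrix (Fin m) (Fin n) ℝ) :
    IsOneProductWith S Finset.univ :=
  isOneProductWith_of_mul_agreeCount fun x => by
    rw [Finset.compl_univ, agreeCount_empty, mul_comm]

theorem IsOneProductWith.compl {m n : ℕ} {S : Matrix (Fin m) (Fin n) ℝ} {X : Finset (Fin m)}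
    (h : IsOneProductWith S X) : IsOneProductWith S Xᶜ :=
  isOneProductWith_of_mul_agreeCount fun x => by
    rw [compl_compl, mul_comm (agreeCount S Xᶜ x), ← Finset.union_compl X]
    exact h.mul_agreeCount_union subset_rfl subset_rfl x

theorem IsOneProductWith.inter {m n : ℕ} {S : Matrix (Fin m) (Fin n) ℝ} {X Y : Finset (Fin m)}
    (hX : IsOneProductWith S X) (hY : IsOneProductWith S Y) : IsOneProductWith S (X ∩ Y) := by
  refine isOneProductWith_of_mul_agreeCount fun x => ?_
  rcases Nat.eq_zero_or_pos n with rfl | hn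
  · simp [agreeCount]
  have e1 : X ∪ Xᶜ = Finset.univ := Finset.union_compl X
  have e2 : X ∩ Y ∪ X \ Y = X := by grind
  have e4 : X \ Y ∪ Xᶜ = (X ∩ Y)ᶜ := by grind [Finset.mem_compl]
  have h1 := hX.mul_agreeCount_union (A := X) (B := Xᶜ) subset_rfl subset_rfl x
  have h2 := hY.mul_agreeCount_union (A := X ∩ Y) (B := X \ Y) (by grind)
    (by grind [Finset.mem_compl]) x
  have h4 := hX.mul_agreeCount_union (A := X \ Y) (B := Xᶜ) (by grind) subset_rfl x
  rw [e1] at h1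
  rw [e2] at h2
  rw [e4] at h4
  apply Nat.eq_of_mul_eq_mul_left hn
  rw [h1, ← mul_assoc, h2, mul_left_comm n, h4, mul_assoc]

/-- If `S ∈ ℝ^{m×n}` is a 1-product with respect to some partition of `[m]`
into two nonempty parts, then there is a partition `{X1, …, Xt}` of `[m]` with `t ≥ 2`
satisfying (1) and (2) above, and any partition of `[m]` satisfying (1) and (2) equals it. -/
theorem unique_finest_product_partition {m n : ℕ} (S : Matrix (Fin m) (Fin n) ℝ)
    (h : ∃ X : Finset (Fin m), X.Nonempty ∧ X ≠ Finset.univ ∧ IsOneProductWith S X) :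
    ∃ P : Finset (Finset (Fin m)),
      IsFinestProductPartition S P ∧ 2 ≤ P.card ∧
        ∀ Q : Finset (Finset (Fin m)), IsFinestProductPartition S Q → Q = P := by
  classical
  have mem_cover : ∀ Q, IsFinestProductPartition S Q → ∀ i, ∃ Y ∈ Q, i ∈ Y := by
    intro Q hQ i
    simpa using (hQ.2.2.1 ▸ Finset.mem_univ i : i ∈ Q.biUnion id)
  set P : Finset (Finset (Fin m)) := Finset.univ.filter fun X => X.Nonempty ∧
    IsOneProductWith S X ∧ ∀ Y ⊆ X, Y.Nonempty → Y ≠ X → ¬ IsOneProductWith S Y with hPdef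
  have memP : ∀ X, X ∈ P ↔ X.Nonempty ∧ IsOneProductWith S X ∧
      ∀ Y ⊆ X, Y.Nonempty → Y ≠ X → ¬ IsOneProductWith S Y := by simp [hPdef]
  have eq_of_mem : ∀ X ∈ P, ∀ Y ∈ P, ∀ i, i ∈ X → i ∈ Y → X = Y := by
    intro X hX Y hY i hiX hiY
    obtain ⟨-, hX1, hX2⟩ := (memP X).1 hX
    obtain ⟨-, hY1, hY2⟩ := (memP Y).1 hY
    have hne : (X ∩ Y).Nonempty := ⟨i, Finset.mem_inter.2 ⟨hiX, hiY⟩⟩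
    have h1 : X ∩ Y = X := by
      by_contra hc
      exact hX2 _ Finset.inter_subset_left hne hc (hX1.inter hY1)
    have h2 : X ∩ Y = Y := by
      by_contra hc
      exact hY2 _ Finset.inter_subset_right hne hc (hX1.inter hY1)
    exact h1.symm.trans h2
  have hP : IsFinestProductPartition S P := by
    refine ⟨fun X hX => ((memP X).1 hX).1, ?_, ?_, fun X hX => ((memP X).1 hX).2.1,
      fun X hX => ((memP X).1 hX).2.2⟩
    · intro X hX Y hY hne
      exact Finset.disjoint_left.2 fun i hiX hiY => hne (eq_of_mem X hX Y hY i hiX hiY)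
    · refine Finset.eq_univ_of_forall fun i => ?_
      obtain ⟨T, hT⟩ := Set.Finite.exists_minimal
        (Set.toFinite {X : Finset (Fin m) | i ∈ X ∧ IsOneProductWith S X})
        ⟨Finset.univ, Finset.mem_univ i, isOneProductWith_univ S⟩
      refine Finset.mem_biUnion.2 ⟨T, (memP T).2 ⟨⟨i, hT.prop.1⟩, hT.prop.2, ?_⟩, hT.prop.1⟩
      rintro Y hYT ⟨y, hy⟩ hne hY
      by_cases hi : i ∈ Y
      · exact hne (hYT.antisymm (hT.le_of_le ⟨hi, hY⟩ hYT))
      · have hle := hT.le_of_le (y := T ∩ Yᶜ)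
          ⟨Finset.mem_inter.2 ⟨hT.prop.1, Finset.mem_compl.2 hi⟩, hT.prop.2.inter hY.compl⟩
          Finset.inter_subset_left
        exact Finset.mem_compl.1 (Finset.mem_inter.1 (hle (hYT hy))).2 hy
  refine ⟨P, hP, ?_, fun Q hQ => ?_⟩
  · obtain ⟨X, ⟨i, hi⟩, hXu, hX⟩ := h
    obtain ⟨A, hA, hiA⟩ := mem_cover P hP i
    by_contra hlt
    have hAu : A = Finset.univ := by
      refine Finset.eq_univ_of_forall fun k => ?_
      obtain ⟨B, hB, hkB⟩ := mem_cover P hP k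
      rwa [Finset.card_le_one.1 (by omega) A hA B hB]
    exact ((memP A).1 hA).2.2 X (hAu ▸ Finset.subset_univ X) ⟨i, hi⟩ (hAu ▸ hXu) hX
  · have hQP : Q ⊆ P := fun Y hY =>
      (memP Y).2 ⟨hQ.1 Y hY, hQ.2.2.2.1 Y hY, hQ.2.2.2.2 Y hY⟩
    refine hQP.antisymm fun X hX => ?_
    obtain ⟨i, hi⟩ := hP.1 X hX
    obtain ⟨Y, hY, hiY⟩ := mem_cover Q hQ i
    rwa [eq_of_mem X hX Y (hQP hY) i hi hiY]
end
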